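/- Let G : [0,1]ⁿ → ℝ be a C^σ function compactly supported in [0,1)ⁿ, and let 1 ≤ σ ≤ n. Then lim_{ε→0⁺} ε ∫_{[0,1]ⁿ} G(x) / (x₁⋯x_σ · (log(e^σ/(x₁⋯x_σ)))^{σ+ε}) dx = (1/(σ−1)!) ∫_{[0,1]^{n−σ}} G(0,…,0, x_{σ+1},…,x_n) dx_{σ+1}⋯dx_n. -/

import Mathlib

open MeasureTheory Filter Topology Real Set

/-- The kernel `1 / (∏ i ∈ s, x i) * (a - ∑ i ∈ s, log (x i)) ^ (-p)`. -/
noncomputable def logWeight {ι : Type*} (s : Finset ι) (a p : ℝ) (x : ι → ℝ) : ℝ :=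
  (∏ i ∈ s, x i)⁻¹ * (a - ∑ i ∈ s, log (x i)) ^ (-p)

section logWeight

variable {ι : Type*} {s : Finset ι} {a p : ℝ} {x : ι → ℝ}

lemma sum_log_nonpos_of_mem_Ioc (hx : ∀ i ∈ s, x i ∈ Ioc (0 : ℝ) 1) :
    ∑ i ∈ s, log (x i) ≤ 0 :=
  Finset.sum_nonpos fun i hi => log_nonpos (hx i hi).1.le (hx i hi).2

lemma logWeight_nonneg (ha : 0 < a) (hx : ∀ i ∈ s, x i ∈ Ioc (0 : ℝ) 1) :
    0 ≤ logWeight s a p x := by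
  have := sum_log_nonpos_of_mem_Ioc hx
  exact mul_nonneg (inv_nonneg.2 (Finset.prod_nonneg fun i hi => (hx i hi).1.le))
    (rpow_nonneg (by linarith) _)

@[fun_prop]
lemma measurable_logWeight : Measurable (logWeight s a p) := by
  unfold logWeight
  fun_prop

lemma mul_logWeight_le_erase [DecidableEq ι] (ha : 0 < a) (hp : 0 ≤ p)
    (hx : ∀ i ∈ s, x i ∈ Ioc (0 : ℝ) 1) {i : ι} (hi : i ∈ s) :
    x i * logWeight s a p x ≤ logWeight (s.erase i) a p x := by
  have hx' : ∀ j ∈ s.erase i, x j ∈ Ioc (0 : ℝ) 1 := fun j hj => hx j (Finset.mem_of_mem_erase hj)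
  have h0 := sum_log_nonpos_of_mem_Ioc hx'
  have hlog := log_nonpos (hx i hi).1.le (hx i hi).2
  have hxi := (hx i hi).1
  unfold logWeight
  rw [← Finset.mul_prod_erase s x hi, ← Finset.add_sum_erase s (fun j => log (x j)) hi, mul_inv,
    mul_assoc, mul_inv_cancel_left₀ hxi.ne']
  refine mul_le_mul_of_nonneg_left ?_
    (inv_nonneg.2 (Finset.prod_nonneg fun j hj => (hx' j hj).1.le))
  exact rpow_le_rpow_of_nonpos (by linarith) (by linarith) (by linarith)

lemma lintegral_inv_mul_sub_log_rpow (ha : 0 < a) (hp : 1 < p) :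
    ∫⁻ u in Ioc (0 : ℝ) 1, ENNReal.ofReal (u⁻¹ * (a - log u) ^ (-p)) =
      ENNReal.ofReal (a ^ (1 - p) * (p - 1)⁻¹) := by
  have himage : (fun t => exp (a - t)) '' Ici a = Ioc (0 : ℝ) 1 := by
    ext u
    constructor
    · rintro ⟨t, ht, rfl⟩
      exact ⟨exp_pos _, exp_le_one_iff.2 (sub_nonpos.2 ht)⟩
    · rintro ⟨h0, h1⟩
      refine ⟨a - log u, ?_, by simp [exp_log h0]⟩
      have := log_nonpos h0.le h1
      simp only [mem_Ici]
      linarith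
  have hderiv : ∀ t ∈ Ici a,
      HasDerivWithinAt (fun t => exp (a - t)) (exp (a - t) * (-1)) (Ici a) t := fun t _ =>
    ((hasDerivAt_id t).const_sub a).exp.hasDerivWithinAt
  have hinj : InjOn (fun t => exp (a - t)) (Ici a) := fun t _ u _ h => by
    have := exp_injective h
    linarith
  rw [← himage, lintegral_image_eq_lintegral_abs_deriv_mul measurableSet_Ici hderiv hinj,
    setLIntegral_congr (Ioi_ae_eq_Ici (a := a)).symm]
  have hcongr : ∀ t ∈ Ioi a, ENNReal.ofReal |exp (a - t) * -1| *
      ENNReal.ofReal ((exp (a - t))⁻¹ * (a - log (exp (a - t))) ^ (-p)) =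
        ENNReal.ofReal (t ^ (-p)) := fun t _ => by
    rw [← ENNReal.ofReal_mul (abs_nonneg _), mul_neg_one, abs_neg, abs_of_pos (exp_pos _),
      mul_inv_cancel_left₀ (exp_pos _).ne', log_exp, sub_sub_cancel]
  rw [setLIntegral_congr_fun measurableSet_Ioi hcongr, ← ofReal_integral_eq_lintegral_ofReal
    (integrableOn_Ioi_rpow_of_lt (by linarith) ha), integral_Ioi_rpow_of_lt (by linarith) ha]
  · congr 1
    rw [show 1 - p = -p + 1 by ring, show p - 1 = -(-p + 1) by ring, inv_neg]
    ring
  · filter_upwards [ae_restrict_mem measurableSet_Ioi] with t ht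
    exact rpow_nonneg (ha.trans ht).le _

/-- Integrating out the variables of `t ⊆ s` lowers the exponent of the kernel by `#t`. -/
lemma lmarginal_logWeight [DecidableEq ι] (ha : 0 < a) {t : Finset ι} (hts : t ⊆ s)
    (htp : (t.card : ℝ) < p) (hx : ∀ i ∈ s \ t, x i ∈ Ioc (0 : ℝ) 1) :
    (∫⋯∫⁻_t, (fun y => ENNReal.ofReal (logWeight s a p y))
        ∂fun _ => (volume : Measure ℝ).restrict (Ioc 0 1)) x =
      ENNReal.ofReal (logWeight (s \ t) a (p - t.card) x *
        ∏ j ∈ Finset.range t.card, (p - (j + 1))⁻¹) := by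
  induction t using Finset.induction_on generalizing x with
  | empty => simp
  | insert i t hi ih =>
    rw [Finset.card_insert_of_notMem hi] at htp ⊢
    push_cast at htp ⊢
    obtain ⟨his, hts⟩ := Finset.insert_subset_iff.1 hts
    have hsdiff : s \ t = insert i (s \ insert i t) := by
      ext j
      by_cases hj : j = i <;> simp [hj, his, hi]
    have hnot : i ∉ s \ insert i t := by simp
    set r := s \ insert i t with hr
    set b := a - ∑ j ∈ r, log (x j) with hb
    have hb0 : 0 < b := by
      have := sum_log_nonpos_of_mem_Ioc hx
      linarith
    have hprod : 0 ≤ (∏ j ∈ r, x j)⁻¹ :=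
      inv_nonneg.2 (Finset.prod_nonneg fun j hj => (hx j hj).1.le)
    have hc : 0 ≤ ∏ j ∈ Finset.range t.card, (p - (j + 1) : ℝ)⁻¹ := by
      refine Finset.prod_nonneg fun j hj => inv_nonneg.2 ?_
      have : ((j + 1 : ℕ) : ℝ) ≤ t.card := by exact_mod_cast Finset.mem_range.1 hj
      push_cast at this
      linarith
    rw [lmarginal_insert _ (by fun_prop) hi]
    have hcongr : ∀ u ∈ Ioc (0 : ℝ) 1,
        (∫⋯∫⁻_t, (fun y => ENNReal.ofReal (logWeight s a p y))
          ∂fun _ => (volume : Measure ℝ).restrict (Ioc 0 1)) (Function.update x i u) =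
        ENNReal.ofReal ((∏ j ∈ r, x j)⁻¹ * ∏ j ∈ Finset.range t.card, (p - (j + 1) : ℝ)⁻¹) *
          ENNReal.ofReal (u⁻¹ * (b - log u) ^ (-(p - t.card))) := by
      intro u hu
      have hne : ∀ j ∈ r, Function.update x i u j = x j := fun j hj =>
        Function.update_of_ne (ne_of_mem_of_not_mem hj hnot) _ _
      rw [ih hts (by linarith), ← ENNReal.ofReal_mul (mul_nonneg hprod hc), hsdiff]
      · congr 1
        unfold logWeight
        rw [Finset.prod_insert hnot, Finset.sum_insert hnot, Function.update_self,
          Finset.prod_congr rfl hne, Finset.sum_congr rfl fun j hj => by rw [hne j hj], mul_inv,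
          show a - (log u + ∑ j ∈ r, log (x j)) = b - log u by rw [hb]; ring]
        ring
      · intro j hj
        rw [hsdiff, Finset.mem_insert] at hj
        rcases hj with rfl | hj
        · simpa using hu
        · rw [hne j hj]
          exact hx j hj
    rw [setLIntegral_congr_fun measurableSet_Ioc hcongr, lintegral_const_mul _ (by fun_prop),
      lintegral_inv_mul_sub_log_rpow hb0 (by linarith), ← ENNReal.ofReal_mul (mul_nonneg hprod hc),
      Finset.prod_range_succ]
    congr 1
    unfold logWeight
    rw [show 1 - (p - t.card) = -(p - (t.card + 1)) by ring,
      show p - t.card - 1 = p - (t.card + 1) by ring]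
    ring

variable [Fintype ι]

/-- The uniform probability measure on the unit cube `(0, 1]^ι`. -/
noncomputable def unitCubeMeasure (ι : Type*) [Fintype ι] : Measure (ι → ℝ) :=
  Measure.pi fun _ : ι => (volume : Measure ℝ).restrict (Ioc 0 1)

instance : IsProbabilityMeasure ((volume : Measure ℝ).restrict (Ioc 0 1)) :=
  ⟨by simp⟩

instance : IsProbabilityMeasure (unitCubeMeasure ι) := by
  unfold unitCubeMeasure
  infer_instance

lemma restrict_pi_Ioc_eq_unitCubeMeasure :
    (volume : Measure (ι → ℝ)).restrict (univ.pi fun _ => Ioc (0 : ℝ) 1) = unitCubeMeasure ι := by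
  rw [unitCubeMeasure, volume_pi, Measure.restrict_pi_pi]

lemma ae_unitCubeMeasure_mem : ∀ᵐ x ∂unitCubeMeasure ι, ∀ i, x i ∈ Ioc (0 : ℝ) 1 := by
  rw [← restrict_pi_Ioc_eq_unitCubeMeasure]
  filter_upwards [ae_restrict_mem (MeasurableSet.univ_pi fun _ => measurableSet_Ioc)] with x hx i
  exact hx i (mem_univ i)

lemma lintegral_logWeight (ha : 0 < a) (hp : (s.card : ℝ) < p) :
    ∫⁻ x, ENNReal.ofReal (logWeight s a p x) ∂unitCubeMeasure ι =
      ENNReal.ofReal (a ^ (s.card - p) * ∏ j ∈ Finset.range s.card, (p - (j + 1))⁻¹) := by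
  classical
  have hmeas : Measurable fun x => ENNReal.ofReal (logWeight s a p x) := by fun_prop
  rw [unitCubeMeasure, lintegral_eq_lmarginal_univ (fun _ => 0),
    ← Finset.union_compl s, Finset.union_comm, lmarginal_union _ _ hmeas disjoint_compl_left]
  have hconst : ∀ x : ι → ℝ, (∫⋯∫⁻_s, (fun y => ENNReal.ofReal (logWeight s a p y))
        ∂fun _ => (volume : Measure ℝ).restrict (Ioc 0 1)) x =
      ENNReal.ofReal (a ^ (s.card - p) * ∏ j ∈ Finset.range s.card, (p - (j + 1))⁻¹) := fun x => by
    rw [lmarginal_logWeight ha subset_rfl hp (by simp)]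
    simp [logWeight]
  rw [funext hconst]
  simp [lmarginal]

lemma integrable_logWeight (ha : 0 < a) (hp : (s.card : ℝ) < p) :
    Integrable (logWeight s a p) (unitCubeMeasure ι) := by
  refine ⟨measurable_logWeight.aestronglyMeasurable, ?_⟩
  rw [hasFiniteIntegral_iff_ofReal, lintegral_logWeight ha hp]
  · exact ENNReal.ofReal_lt_top
  · filter_upwards [ae_unitCubeMeasure_mem] with x hx
    exact logWeight_nonneg ha fun i _ => hx i

lemma integral_logWeight (ha : 0 < a) (hp : (s.card : ℝ) < p) :
    ∫ x, logWeight s a p x ∂unitCubeMeasure ι =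
      a ^ (s.card - p) * ∏ j ∈ Finset.range s.card, (p - (j + 1))⁻¹ := by
  rw [integral_eq_lintegral_of_nonneg_ae, lintegral_logWeight ha hp, ENNReal.toReal_ofReal]
  · refine mul_nonneg (rpow_nonneg ha.le _) (Finset.prod_nonneg fun j hj => inv_nonneg.2 ?_)
    have : ((j + 1 : ℕ) : ℝ) ≤ s.card := by exact_mod_cast Finset.mem_range.1 hj
    push_cast at this
    linarith
  · filter_upwards [ae_unitCubeMeasure_mem] with x hx
    exact logWeight_nonneg ha fun i _ => hx i
  · exact measurable_logWeight.aestronglyMeasurable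

lemma tendsto_prod_inv_sub (m : ℕ) :
    Tendsto (fun ε : ℝ => ∏ j ∈ Finset.range m, (((m + 1 : ℕ) : ℝ) + ε - (j + 1))⁻¹)
      (𝓝[>] 0) (𝓝 (1 / (m.factorial : ℝ))) := by
  have hfac : (1 / (m.factorial : ℝ)) =
      ∏ j ∈ Finset.range m, (((m + 1 : ℕ) : ℝ) + 0 - (j + 1))⁻¹ := by
    rw [← Nat.descFactorial_self, Nat.descFactorial_eq_prod_range, Finset.prod_inv_distrib, one_div]
    push_cast
    congr 1
    refine Finset.prod_congr rfl fun j hj => ?_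
    rw [Nat.cast_sub (Finset.mem_range.1 hj).le]
    ring
  rw [hfac]
  refine tendsto_finsetProd _ fun j hj => Tendsto.inv₀ ?_ ?_
  · exact (Continuous.tendsto (by fun_prop) 0).mono_left nhdsWithin_le_nhds
  · have : (j : ℝ) < m := by exact_mod_cast Finset.mem_range.1 hj
    push_cast
    intro h
    linarith

lemma tendsto_rpow_const_sub (ha : 0 < a) (c : ℝ) :
    Tendsto (fun ε : ℝ => a ^ (c - ε)) (𝓝[>] 0) (𝓝 (a ^ c)) := by
  have h : Continuous fun ε : ℝ => a ^ (c - ε) :=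
    Continuous.rpow continuous_const (by fun_prop) fun _ => Or.inl ha.ne'
  simpa using (h.tendsto 0).mono_left nhdsWithin_le_nhds

lemma tendsto_mul_integral_logWeight (ha : 0 < a) {m : ℕ} (hs : s.card = m + 1) :
    Tendsto (fun ε : ℝ => ε * ∫ x, logWeight s a (s.card + ε) x ∂unitCubeMeasure ι)
      (𝓝[>] 0) (𝓝 (1 / (m.factorial : ℝ))) := by
  have h := (tendsto_rpow_const_sub ha 0).mul (tendsto_prod_inv_sub m)
  rw [rpow_zero, one_mul] at h
  refine h.congr' ?_
  filter_upwards [self_mem_nhdsWithin] with ε hε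
  have hε : 0 < ε := hε
  rw [integral_logWeight ha (by linarith), hs, Finset.prod_range_succ,
    show ((m + 1 : ℕ) : ℝ) - ((m + 1 : ℕ) + ε) = 0 - ε by ring,
    show ((m + 1 : ℕ) : ℝ) + ε - (m + 1) = ε by push_cast; ring]
  field_simp

lemma tendsto_mul_integral_logWeight_erase [DecidableEq ι] (ha : 0 < a) {i : ι} (hi : i ∈ s) :
    Tendsto (fun ε : ℝ => ε * ∫ x, logWeight (s.erase i) a (s.card + ε) x ∂unitCubeMeasure ι)
      (𝓝[>] 0) (𝓝 0) := by
  obtain ⟨m, hs⟩ := Nat.exists_eq_succ_of_ne_zero (Finset.card_ne_zero_of_mem hi)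
  have hcard : (s.erase i).card = m := by rw [Finset.card_erase_of_mem hi, hs]; simp
  have h := (tendsto_nhdsWithin_of_tendsto_nhds (s := Ioi (0 : ℝ)) (tendsto_id (x := 𝓝 0))).mul
    ((tendsto_rpow_const_sub ha (-1)).mul (tendsto_prod_inv_sub m))
  rw [zero_mul] at h
  refine h.congr' ?_
  filter_upwards [self_mem_nhdsWithin] with ε hε
  have hε : 0 < ε := hε
  rw [integral_logWeight ha (by rw [hcard, hs]; push_cast; linarith), hcard, hs,
    show (m : ℝ) - ((m.succ : ℕ) + ε) = -1 - ε by push_cast; ring]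
  rfl

lemma integral_mul_logWeight_eq_mul {g : (ι → ℝ) → ℝ} (hg : Measurable g)
    (hgs : ∀ x y, (∀ i ∉ s, x i = y i) → g x = g y) :
    ∫ x, g x * logWeight s a p x ∂unitCubeMeasure ι =
      (∫ x, g x ∂unitCubeMeasure ι) * ∫ x, logWeight s a p x ∂unitCubeMeasure ι := by
  classical
  have hind : ProbabilityTheory.iIndepFun (fun i (x : ι → ℝ) => x i) (unitCubeMeasure ι) :=
    ProbabilityTheory.iIndepFun_pi (X := fun _ => id) fun _ => aemeasurable_id
  have hpair := hind.indepFun_finset sᶜ s disjoint_compl_left fun i => measurable_pi_apply i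
  let φ : ((sᶜ : Finset ι) → ℝ) → ι → ℝ := fun y i => if h : i ∈ sᶜ then y ⟨i, h⟩ else 0
  have hφ : Measurable φ := by
    refine measurable_pi_lambda _ fun i => ?_
    by_cases h : i ∈ sᶜ <;> simp only [φ, h, dite_true, dite_false] <;> fun_prop
  have hgW := hpair.comp (hg.comp hφ) (measurable_logWeight (s := Finset.univ) (a := a) (p := p))
  have hg_eq : (g ∘ φ) ∘ (fun x (i : (sᶜ : Finset ι)) => x i) = g := by
    funext x
    refine hgs _ _ fun i hi => ?_
    simp [φ, hi]
  have hW_eq : logWeight Finset.univ a p ∘ (fun x (i : s) => x i) = logWeight s a p := by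
    funext x
    simp only [logWeight, Function.comp]
    rw [Finset.prod_coe_sort s x, Finset.sum_coe_sort s fun i => log (x i)]
  rw [hg_eq, hW_eq] at hgW
  exact hgW.integral_fun_mul_eq_mul_integral hg.aestronglyMeasurable
    measurable_logWeight.aestronglyMeasurable

/-- The normalised kernel concentrates on the face `{x i = 0 for i ∈ s}` of the cube. -/
lemma tendsto_mul_integral_mul_logWeight [DecidableEq ι] (ha : 0 < a) {m : ℕ} (hs : s.card = m + 1)
    {G : (ι → ℝ) → ℝ} (hG : Continuous G) {K : NNReal} (hK : LipschitzOnWith K G (Icc 0 1)) :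
    Tendsto (fun ε : ℝ => ε * ∫ x, G x * logWeight s a (s.card + ε) x ∂unitCubeMeasure ι)
      (𝓝[>] 0) (𝓝 ((1 / (m.factorial : ℝ)) *
        ∫ x, G (fun i => if i ∈ s then 0 else x i) ∂unitCubeMeasure ι)) := by
  set g : (ι → ℝ) → ℝ := fun x => G (fun i => if i ∈ s then 0 else x i) with hg
  have hgc : Continuous g := by
    refine hG.comp (continuous_pi fun i => ?_)
    split_ifs <;> fun_prop
  obtain ⟨C, hC⟩ := (isCompact_Icc (a := (0 : ι → ℝ)) (b := 1)).exists_bound_of_continuousOn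
    hG.continuousOn
  have hmem : ∀ x : ι → ℝ, (∀ i, x i ∈ Ioc (0 : ℝ) 1) → x ∈ Icc (0 : ι → ℝ) 1 := fun x hx =>
    ⟨fun i => (hx i).1.le, fun i => (hx i).2⟩
  have hmem' : ∀ x : ι → ℝ, (∀ i, x i ∈ Ioc (0 : ℝ) 1) →
      (fun i => if i ∈ s then 0 else x i) ∈ Icc (0 : ι → ℝ) 1 := fun x hx => by
    refine ⟨fun i => ?_, fun i => ?_⟩ <;> by_cases h : i ∈ s <;> simp [h, (hx i).1.le, (hx i).2]
  have hdiff : ∀ x : ι → ℝ, (∀ i, x i ∈ Ioc (0 : ℝ) 1) → |G x - g x| ≤ K * ∑ i ∈ s, x i := by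
    intro x hx
    have hsum : 0 ≤ ∑ i ∈ s, x i := Finset.sum_nonneg fun i _ => (hx i).1.le
    refine (hK.dist_le_mul _ (hmem x hx) _ (hmem' x hx)).trans
      (mul_le_mul_of_nonneg_left ((dist_pi_le_iff hsum).2 fun i => ?_) K.2)
    by_cases h : i ∈ s
    · simp only [h, if_true, dist_zero_right, norm_eq_abs, abs_of_pos (hx i).1]
      exact Finset.single_le_sum (f := x) (fun j _ => (hx j).1.le) h
    · simpa [h] using hsum
  have hmain : Tendsto (fun ε : ℝ => ε * ∫ x, g x * logWeight s a (s.card + ε) x ∂unitCubeMeasure ι)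
      (𝓝[>] 0) (𝓝 ((1 / (m.factorial : ℝ)) * ∫ x, g x ∂unitCubeMeasure ι)) := by
    refine ((tendsto_mul_integral_logWeight ha hs).mul_const _).congr fun ε => ?_
    rw [integral_mul_logWeight_eq_mul hgc.measurable]
    · ring
    · intro x y hxy
      refine congrArg G (funext fun i => ?_)
      by_cases h : i ∈ s <;> simp [h, hxy i]
  have herr : Tendsto (fun ε : ℝ => ε * ∫ x, (G x - g x) * logWeight s a (s.card + ε) x
      ∂unitCubeMeasure ι) (𝓝[>] 0) (𝓝 0) := by
    have hbound : Tendsto (fun ε : ℝ => K * ∑ i ∈ s, ε * ∫ x, logWeight (s.erase i) a (s.card + ε) x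
        ∂unitCubeMeasure ι) (𝓝[>] 0) (𝓝 0) := by
      simpa using (tendsto_finsetSum s fun i hi =>
        tendsto_mul_integral_logWeight_erase ha hi).const_mul (K : ℝ)
    refine squeeze_zero_norm' ?_ hbound
    filter_upwards [self_mem_nhdsWithin] with ε hε
    have hε : 0 < ε := hε
    have hint : ∀ i ∈ s, Integrable (logWeight (s.erase i) a (s.card + ε)) (unitCubeMeasure ι) :=
      fun i _ => integrable_logWeight ha <| by
        have : ((s.erase i).card : ℝ) ≤ s.card := by exact_mod_cast Finset.card_erase_le
        linarith
    rw [norm_mul, norm_of_nonneg hε.le, ← Finset.mul_sum, mul_left_comm,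
      ← integral_finsetSum s hint, ← integral_const_mul]
    refine mul_le_mul_of_nonneg_left (norm_integral_le_of_norm_le
      ((integrable_finsetSum s hint).const_mul _) ?_) hε.le
    filter_upwards [ae_unitCubeMeasure_mem] with x hx
    have hW : 0 ≤ logWeight s a (s.card + ε) x := logWeight_nonneg ha fun i _ => hx i
    rw [norm_mul, norm_of_nonneg hW]
    calc ‖G x - g x‖ * logWeight s a (s.card + ε) x
        ≤ (K * ∑ i ∈ s, x i) * logWeight s a (s.card + ε) x :=
          mul_le_mul_of_nonneg_right (hdiff x hx) hW
      _ = K * ∑ i ∈ s, x i * logWeight s a (s.card + ε) x := by rw [mul_assoc, Finset.sum_mul]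
      _ ≤ K * ∑ i ∈ s, logWeight (s.erase i) a (s.card + ε) x :=
          mul_le_mul_of_nonneg_left (Finset.sum_le_sum fun i hi =>
            mul_logWeight_le_erase ha (by positivity) (fun j _ => hx j) hi) K.2
  have hsum := hmain.add herr
  rw [add_zero] at hsum
  refine hsum.congr' ?_
  filter_upwards [self_mem_nhdsWithin] with ε hε
  have hε : 0 < ε := hε
  have hW := integrable_logWeight (ι := ι) (s := s) (p := s.card + ε) ha (by linarith)
  have hGW : Integrable (fun x => G x * logWeight s a (s.card + ε) x) (unitCubeMeasure ι) := by
    refine hW.bdd_mul hG.aestronglyMeasurable (c := C) ?_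
    filter_upwards [ae_unitCubeMeasure_mem] with x hx using hC x (hmem x hx)
  have hgW : Integrable (fun x => g x * logWeight s a (s.card + ε) x) (unitCubeMeasure ι) := by
    refine hW.bdd_mul hgc.aestronglyMeasurable (c := C) ?_
    filter_upwards [ae_unitCubeMeasure_mem] with x hx using hC _ (hmem' x hx)
  simp only [sub_mul]
  rw [integral_sub hGW hgW]
  ring

end logWeight

/-- General model residue computation (`s = σ`): for `G ∈ C^σ_c([0,1)ⁿ)` and
`1 ≤ σ ≤ n`, the residue function of index `σ` converges, as `ε → 0⁺`, to
`1/(σ-1)!` times the integral of `G` restricted to `{x₁ = ⋯ = x_σ = 0}`. -/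
theorem residue_function_general_model (n σ : ℕ) (hσ1 : 1 ≤ σ) (hσn : σ ≤ n)
    (G : (Fin n → ℝ) → ℝ) (hG : ContDiff ℝ (σ : ℕ∞) G)
    (hsupp : ∃ a : ℝ, a < 1 ∧ ∀ x : Fin n → ℝ, (∃ i, a ≤ x i) → G x = 0) :
    Tendsto (fun ε : ℝ => ε * ∫ x in Set.univ.pi (fun _ : Fin n => Ioc (0:ℝ) 1),
        G x / ((∏ i : Fin n, if (i : ℕ) < σ then x i else 1) *
          (Real.log (Real.exp σ / ∏ i : Fin n, if (i : ℕ) < σ then x i else 1))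
            ^ ((σ : ℝ) + ε)))
      (𝓝[>] 0)
      (𝓝 ((1 / (Nat.factorial (σ - 1) : ℝ)) *
        ∫ x in Set.univ.pi (fun _ : Fin n => Ioc (0:ℝ) 1),
          G (fun i => if (i : ℕ) < σ then 0 else x i))) := by
  let s : Finset (Fin n) := Finset.univ.filter fun i => (i : ℕ) < σ
  have hcard : s.card = σ := by
    simp [s, Fin.card_filter_val_lt, hσn]
  obtain ⟨m, rfl⟩ : ∃ m, σ = m + 1 := ⟨σ - 1, by omega⟩
  have hmem : ∀ i, i ∈ s ↔ (i : ℕ) < m + 1 := fun i => by simp [s]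
  have hG1 : ContDiff ℝ 1 G := hG.of_le (by exact_mod_cast hσ1)
  obtain ⟨K, hK⟩ := hG1.locallyLipschitz.locallyLipschitzOn.exists_lipschitzOnWith_of_compact
    (isCompact_Icc (a := (0 : Fin n → ℝ)) (b := 1))
  have h := tendsto_mul_integral_mul_logWeight (a := ((m + 1 : ℕ) : ℝ)) (by positivity) hcard
    hG.continuous hK
  simp only [hcard, hmem] at h
  simp only [restrict_pi_Ioc_eq_unitCubeMeasure, Nat.add_sub_cancel]
  refine h.congr fun ε => congrArg (ε * ·) (integral_congr_ae ?_)
  filter_upwards [ae_unitCubeMeasure_mem] with x hx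
  have hprod : (∏ i : Fin n, if (i : ℕ) < m + 1 then x i else 1) = ∏ i ∈ s, x i := by
    rw [Finset.prod_filter]
  have hpos : 0 < ∏ i ∈ s, x i := Finset.prod_pos fun i _ => (hx i).1
  have hlog : log (exp ((m + 1 : ℕ) : ℝ) / ∏ i ∈ s, x i) =
      ((m + 1 : ℕ) : ℝ) - ∑ i ∈ s, log (x i) := by
    rw [log_div (exp_pos _).ne' hpos.ne', log_exp, log_prod fun i _ => (hx i).1.ne']
  have hsum := sum_log_nonpos_of_mem_Ioc (s := s) fun i _ => hx i
  rw [hprod, hlog, logWeight, rpow_neg (by push_cast at *; linarith [(Nat.cast_nonneg m : (0 : ℝ) ≤ m)]),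
    ← mul_inv, div_eq_mul_inv]
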